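/- In the equitable algebra U, the elements K̃_i^{±1} = X_i^{±1}, Ẽ_i = (1 - X_iZ_i)q_i^{-1}(q_i - q_i^{-1})^{-1}, F̃_i = (Y_i - X_i^{-1})(q_i - q_i^{-1})^{-1} (1 ≤ i ≤ n) satisfy the Chevalley relations (R1)–(R7); consequently there exists a 𝕂(q)-algebra homomorphism from U_q(g) to U sending E_i ↦ Ẽ_i, F_i ↦ F̃_i, K_i^{±1} ↦ K̃_i^{±1}. -/

import Mathlib

open FreeAlgebra
open scoped TensorProduct

noncomputable section

/-- The field `𝕂(q)` of rational functions in the indeterminate `q` over `𝕂`. -/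
abbrev Kq (K : Type) [Field K] : Type := RatFunc K

/-- The indeterminate `q` viewed as an element of `𝕂(q)`. -/
def qv (K : Type) [Field K] : Kq K := RatFunc.X

/-- `q_i = q^{d_i}`, given the exponent `di = d_i`. -/
def qi (K : Type) [Field K] (di : ℕ) : Kq K := qv K ^ di

/-- The quantum integer `[m]_i = (q_i^m - q_i^{-m})/(q_i - q_i⁻¹)`. -/
def qnum (K : Type) [Field K] (di : ℕ) (m : ℤ) : Kq K :=
  (qi K di ^ m - qi K di ^ (-m)) / (qi K di - (qi K di)⁻¹)

/-- The quantum factorial `[m]_i! = [m]_i [m-1]_i ⋯ [1]_i`, with `[0]_i! = 1`. -/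
def qfac (K : Type) [Field K] (di : ℕ) : ℕ → Kq K
  | 0 => 1
  | m + 1 => qnum K di (m + 1) * qfac K di m

/-- The Gaussian binomial coefficient `[m choose r]_i = [m]_i!/([r]_i![m-r]_i!)`. -/
def qbin (K : Type) [Field K] (di m r : ℕ) : Kq K :=
  qfac K di m / (qfac K di r * qfac K di (m - r))

/-- Chevalley generators `E_i, F_i, K_i, K_i⁻¹` of `U_q(g)`. -/
inductive CGen (n : ℕ) : Type
  | E : Fin n → CGen n
  | F : Fin n → CGen n
  | K : Fin n → CGen n
  | Kinv : Fin n → CGen n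

/-- The defining relations (R1)–(R7) of `U_q(g)` in the Chevalley presentation. -/
inductive CRel (K : Type) [Field K] {n : ℕ} (A : Matrix (Fin n) (Fin n) ℤ) (d : Fin n → ℕ) :
    FreeAlgebra (Kq K) (CGen n) → FreeAlgebra (Kq K) (CGen n) → Prop
  | R1a (i : Fin n) : CRel K A d (ι (Kq K) (CGen.K i) * ι (Kq K) (CGen.Kinv i)) 1
  | R1b (i : Fin n) : CRel K A d (ι (Kq K) (CGen.Kinv i) * ι (Kq K) (CGen.K i)) 1
  | R2 (i j : Fin n) : CRel K A d (ι (Kq K) (CGen.K i) * ι (Kq K) (CGen.K j))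
      (ι (Kq K) (CGen.K j) * ι (Kq K) (CGen.K i))
  | R3 (i j : Fin n) : CRel K A d
      (ι (Kq K) (CGen.K i) * ι (Kq K) (CGen.E j) * ι (Kq K) (CGen.Kinv i))
      (qi K (d i) ^ (A i j) • ι (Kq K) (CGen.E j))
  | R4 (i j : Fin n) : CRel K A d
      (ι (Kq K) (CGen.K i) * ι (Kq K) (CGen.F j) * ι (Kq K) (CGen.Kinv i))
      (qi K (d i) ^ (-(A i j)) • ι (Kq K) (CGen.F j))
  | R5 (i j : Fin n) : CRel K A d
      (ι (Kq K) (CGen.E i) * ι (Kq K) (CGen.F j) - ι (Kq K) (CGen.F j) * ι (Kq K) (CGen.E i))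
      (if i = j then (qi K (d i) - (qi K (d i))⁻¹)⁻¹ •
        (ι (Kq K) (CGen.K i) - ι (Kq K) (CGen.Kinv i)) else 0)
  | R6 (i j : Fin n) (hij : i ≠ j) : CRel K A d
      (∑ r ∈ Finset.range ((1 - A i j).toNat + 1),
        ((-1 : Kq K) ^ r * qbin K (d i) (1 - A i j).toNat r) •
          (ι (Kq K) (CGen.E i) ^ ((1 - A i j).toNat - r) * ι (Kq K) (CGen.E j) *
            ι (Kq K) (CGen.E i) ^ r)) 0
  | R7 (i j : Fin n) (hij : i ≠ j) : CRel K A d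
      (∑ r ∈ Finset.range ((1 - A i j).toNat + 1),
        ((-1 : Kq K) ^ r * qbin K (d i) (1 - A i j).toNat r) •
          (ι (Kq K) (CGen.F i) ^ ((1 - A i j).toNat - r) * ι (Kq K) (CGen.F j) *
            ι (Kq K) (CGen.F i) ^ r)) 0

/-- The quantum group `U_q(g)` presented by generators and relations (R1)–(R7). -/
abbrev Uqg (K : Type) [Field K] {n : ℕ} (A : Matrix (Fin n) (Fin n) ℤ) (d : Fin n → ℕ) :=
  RingQuot (CRel K A d)

variable (K : Type) [Field K] {n : ℕ} (A : Matrix (Fin n) (Fin n) ℤ) (d : Fin n → ℕ)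

def genE (i : Fin n) : Uqg K A d := RingQuot.mkAlgHom (Kq K) (CRel K A d) (ι (Kq K) (CGen.E i))
def genF (i : Fin n) : Uqg K A d := RingQuot.mkAlgHom (Kq K) (CRel K A d) (ι (Kq K) (CGen.F i))
def genK (i : Fin n) : Uqg K A d := RingQuot.mkAlgHom (Kq K) (CRel K A d) (ι (Kq K) (CGen.K i))
def genKinv (i : Fin n) : Uqg K A d :=
  RingQuot.mkAlgHom (Kq K) (CRel K A d) (ι (Kq K) (CGen.Kinv i))

/-- Equitable generators `X_i, X_i⁻¹, Y_i, Z_i`. -/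
inductive EGen (n : ℕ) : Type
  | X : Fin n → EGen n
  | Xinv : Fin n → EGen n
  | Y : Fin n → EGen n
  | Z : Fin n → EGen n

/-- The defining relations (E1)–(E8) of the equitable presentation. -/
inductive ERel (K : Type) [Field K] {n : ℕ} (A : Matrix (Fin n) (Fin n) ℤ) (d : Fin n → ℕ) :
    FreeAlgebra (Kq K) (EGen n) → FreeAlgebra (Kq K) (EGen n) → Prop
  | E1a (i : Fin n) : ERel K A d (ι (Kq K) (EGen.X i) * ι (Kq K) (EGen.Xinv i)) 1
  | E1b (i : Fin n) : ERel K A d (ι (Kq K) (EGen.Xinv i) * ι (Kq K) (EGen.X i)) 1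
  | E2 (i j : Fin n) : ERel K A d (ι (Kq K) (EGen.X i) * ι (Kq K) (EGen.X j))
      (ι (Kq K) (EGen.X j) * ι (Kq K) (EGen.X i))
  | E3 (i j : Fin n) : ERel K A d
      (ι (Kq K) (EGen.Y i) * ι (Kq K) (EGen.X j) -
        qi K (d i) ^ (A i j) • (ι (Kq K) (EGen.X j) * ι (Kq K) (EGen.Y i)))
      ((1 - qi K (d i) ^ (A i j)) • (ι (Kq K) (EGen.Xinv i) * ι (Kq K) (EGen.X j)))
  | E4 (i j : Fin n) : ERel K A d
      (ι (Kq K) (EGen.X i) * ι (Kq K) (EGen.Z j) -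
        qi K (d i) ^ (A i j) • (ι (Kq K) (EGen.Z j) * ι (Kq K) (EGen.X i)))
      ((1 - qi K (d i) ^ (A i j)) • (ι (Kq K) (EGen.X i) * ι (Kq K) (EGen.Xinv j)))
  | E5 (i : Fin n) : ERel K A d
      (ι (Kq K) (EGen.Z i) * ι (Kq K) (EGen.Y i) -
        (qi K (d i) ^ 2) • (ι (Kq K) (EGen.Y i) * ι (Kq K) (EGen.Z i)))
      ((1 - qi K (d i) ^ 2) • 1)
  | E6 (i j : Fin n) (hij : i ≠ j) : ERel K A d
      (ι (Kq K) (EGen.Z i) * ι (Kq K) (EGen.Y j) -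
        qi K (d i) ^ (A i j) • (ι (Kq K) (EGen.Y j) * ι (Kq K) (EGen.Z i)))
      ((1 - qi K (d i) ^ (A i j)) • (ι (Kq K) (EGen.Xinv i) * ι (Kq K) (EGen.Xinv j)))
  | E7 (i j : Fin n) (hij : i ≠ j) : ERel K A d
      (∑ r ∈ Finset.range ((1 - A i j).toNat + 1),
        ((-1 : Kq K) ^ r * qbin K (d i) (1 - A i j).toNat r) •
          (ι (Kq K) (EGen.Y i) ^ ((1 - A i j).toNat - r) * ι (Kq K) (EGen.Y j) *
            ι (Kq K) (EGen.Y i) ^ r))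
      ((∏ s ∈ Finset.range ((-(A i j)).toNat + 1), (1 - qi K (d i) ^ (A i j + 2 * (s : ℤ)))) •
        (ι (Kq K) (EGen.Xinv i) ^ (1 - A i j).toNat * ι (Kq K) (EGen.Xinv j)))
  | E8 (i j : Fin n) (hij : i ≠ j) : ERel K A d
      (∑ r ∈ Finset.range ((1 - A i j).toNat + 1),
        ((-1 : Kq K) ^ r * qbin K (d i) (1 - A i j).toNat r) •
          (ι (Kq K) (EGen.Z i) ^ ((1 - A i j).toNat - r) * ι (Kq K) (EGen.Z j) *
            ι (Kq K) (EGen.Z i) ^ r))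
      ((∏ s ∈ Finset.range ((-(A i j)).toNat + 1), (1 - qi K (d i) ^ (A i j + 2 * (s : ℤ)))) •
        (ι (Kq K) (EGen.Xinv i) ^ (1 - A i j).toNat * ι (Kq K) (EGen.Xinv j)))

/-- The equitable algebra `U` presented by generators and relations (E1)–(E8). -/
abbrev Ueqg (K : Type) [Field K] {n : ℕ} (A : Matrix (Fin n) (Fin n) ℤ) (d : Fin n → ℕ) :=
  RingQuot (ERel K A d)

def genX (i : Fin n) : Ueqg K A d := RingQuot.mkAlgHom (Kq K) (ERel K A d) (ι (Kq K) (EGen.X i))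
def genXinv (i : Fin n) : Ueqg K A d :=
  RingQuot.mkAlgHom (Kq K) (ERel K A d) (ι (Kq K) (EGen.Xinv i))
def genY (i : Fin n) : Ueqg K A d := RingQuot.mkAlgHom (Kq K) (ERel K A d) (ι (Kq K) (EGen.Y i))
def genZ (i : Fin n) : Ueqg K A d := RingQuot.mkAlgHom (Kq K) (ERel K A d) (ι (Kq K) (EGen.Z i))

/-- `A` is a symmetrizable generalized Cartan matrix with symmetrizing positive,
relatively prime integers `d_i`, and `n ≥ 1`. -/
def IsSymmetrizableGCM {n : ℕ} (A : Matrix (Fin n) (Fin n) ℤ) (d : Fin n → ℕ) : Prop :=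
  0 < n ∧ (∀ i, A i i = 2) ∧ (∀ i j, i ≠ j → A i j ≤ 0) ∧
    (∀ i, 0 < d i) ∧ Finset.univ.gcd d = 1 ∧
    (∀ i j, (d i : ℤ) * A i j = (d j : ℤ) * A j i)

end

noncomputable section Statement5

variable (K : Type) [Field K] {n : ℕ} (A : Matrix (Fin n) (Fin n) ℤ) (d : Fin n → ℕ)

/-- `K̃_i = X_i`. -/
def tilK (i : Fin n) : Ueqg K A d := genX K A d i
/-- `K̃_i⁻¹ = X_i⁻¹`. -/
def tilKinv (i : Fin n) : Ueqg K A d := genXinv K A d i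
/-- `Ẽ_i = (1 - X_iZ_i)q_i⁻¹(q_i - q_i⁻¹)⁻¹`. -/
def tilE (i : Fin n) : Ueqg K A d :=
  ((qi K (d i))⁻¹ * (qi K (d i) - (qi K (d i))⁻¹)⁻¹) • (1 - genX K A d i * genZ K A d i)
/-- `F̃_i = (Y_i - X_i⁻¹)(q_i - q_i⁻¹)⁻¹`. -/
def tilF (i : Fin n) : Ueqg K A d :=
  (qi K (d i) - (qi K (d i))⁻¹)⁻¹ • (genY K A d i - genXinv K A d i)

section QSerre

variable {F B : Type*} [Field F] [Ring B] [Algebra F B]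

/-- The iterated twisted commutator: start from `v` and apply `t ↦ u t - c₀ t u`,
`t ↦ u t - c₁ t u`, and so on. -/
def iterTwist (u v : B) (c : ℕ → F) : ℕ → B
  | 0 => v
  | k + 1 => u * iterTwist u v c k - c k • (iterTwist u v c k * u)

theorem iterTwist_add (u v v' : B) (c : ℕ → F) (k : ℕ) :
    iterTwist u (v + v') c k = iterTwist u v c k + iterTwist u v' c k := by
  induction k with
  | zero => rfl
  | succ k ih =>
    simp only [iterTwist, ih, mul_add, add_mul, smul_add]
    abel

theorem iterTwist_smul (s t : F) (u v : B) (c : ℕ → F) (k : ℕ) :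
    iterTwist (s • u) (t • v) c k = (s ^ k * t) • iterTwist u v c k := by
  induction k with
  | zero => simp [iterTwist]
  | succ k ih =>
    simp only [iterTwist, ih, smul_mul_assoc, mul_smul_comm]
    module

theorem mul_iterTwist_of_twist {x u v : B} {z w : F} (hu : x * u = z • (u * x))
    (hv : x * v = w • (v * x)) (c : ℕ → F) (k : ℕ) :
    x * iterTwist u v c k = (w * z ^ k) • (iterTwist u v c k * x) := by
  induction k with
  | zero => simpa [iterTwist] using hv
  | succ k ih =>
    have h1 : x * (u * iterTwist u v c k) = (w * z ^ (k + 1)) • (u * iterTwist u v c k * x) := by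
      rw [← mul_assoc, hu, smul_mul_assoc, mul_assoc, ih, mul_smul_comm, ← mul_assoc]
      module
    have h2 : x * (iterTwist u v c k * u) = (w * z ^ (k + 1)) • (iterTwist u v c k * u * x) := by
      rw [← mul_assoc, ih, smul_mul_assoc, mul_assoc, hu, mul_smul_comm, ← mul_assoc]
      module
    simp only [iterTwist, mul_sub, sub_mul, mul_smul_comm, smul_mul_assoc, h1, h2]
    module

theorem iterTwist_add_left_of_twist {x u v : B} {z w : F} (hu : x * u = z • (u * x))
    (hv : x * v = w • (v * x)) (k : ℕ) :
    iterTwist (u + x) v (fun l => w * z ^ l) k = iterTwist u v (fun l => w * z ^ l) k := by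
  induction k with
  | zero => rfl
  | succ k ih =>
    simp only [iterTwist, ih, add_mul, mul_add, mul_iterTwist_of_twist hu hv]
    module

theorem mul_pow_mul_of_twist {x y u : B} {z w : F} (hu : u * x = z • (x * u))
    (hy : u * y = w • (y * u)) (k : ℕ) :
    u * (x ^ k * y) = (w * z ^ k) • (x ^ k * y * u) := by
  induction k with
  | zero => simpa using hy
  | succ k ih =>
    rw [pow_succ', mul_assoc, ← mul_assoc u, hu, smul_mul_assoc, mul_assoc, ih, mul_smul_comm,
      ← mul_assoc]
    module

theorem iterTwist_add_eq_prod {x y u : B} {z w : F} (hu : u * x = z • (x * u))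
    (hy : u * y = w • (y * u)) (hxy : x * y = y * x) (k : ℕ) :
    iterTwist (u + x) y (fun l => w * z ^ l) k =
      (∏ l ∈ Finset.range k, (1 - w * z ^ l)) • (x ^ k * y) := by
  induction k with
  | zero => simp [iterTwist]
  | succ k ih =>
    have h : x ^ k * y * x = x ^ (k + 1) * y := by rw [mul_assoc, ← hxy, ← mul_assoc, pow_succ]
    have h' : x * (x ^ k * y) = x ^ (k + 1) * y := by rw [← mul_assoc, pow_succ']
    rw [Finset.prod_range_succ]
    simp only [iterTwist, ih, add_mul, mul_add, mul_smul_comm, smul_mul_assoc, h, h',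
      mul_pow_mul_of_twist hu hy]
    module

theorem iterTwist_mul_of_twist {x y u v : B} {z w : F} (hu : u * x = z • (x * u))
    (huy : u * y = w • (y * u)) (hv : v * x = w • (x * v)) (hz : z ≠ 0) (hw : w ≠ 0)
    (hxy : x * y = y * x) (c : ℕ → F) (k : ℕ) :
    ∃ b : F, b ≠ 0 ∧
      iterTwist (x * u) (y * v) c k = b • (x ^ k * y * iterTwist u v c k) := by
  induction k with
  | zero => exact ⟨1, one_ne_zero, by simp [iterTwist]⟩
  | succ k ih =>
    obtain ⟨b, hb, h⟩ := ih
    have twist (k : ℕ) : iterTwist u v c k * x = (w * z ^ k) • (x * iterTwist u v c k) := by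
      have inv {t : B} {s : F} (hs : s ≠ 0) (ht : t * x = s • (x * t)) :
          x * t = s⁻¹ • (t * x) := by rw [ht, smul_smul, inv_mul_cancel₀ hs, one_smul]
      rw [mul_iterTwist_of_twist (inv hz hu) (inv hw hv), smul_smul,
        show w * z ^ k * (w⁻¹ * z⁻¹ ^ k) = 1 by rw [inv_pow]; field_simp, one_smul]
    refine ⟨b * (w * z ^ k), by positivity, ?_⟩
    have h1 : x * u * (x ^ k * y * iterTwist u v c k) =
        (w * z ^ k) • (x ^ (k + 1) * y * (u * iterTwist u v c k)) := by
      rw [mul_assoc x u, ← mul_assoc u, mul_pow_mul_of_twist hu huy, smul_mul_assoc,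
        mul_smul_comm, pow_succ']
      simp only [mul_assoc]
    have h2 : x ^ k * y * iterTwist u v c k * (x * u) =
        (w * z ^ k) • (x ^ (k + 1) * y * (iterTwist u v c k * u)) := by
      rw [mul_assoc, ← mul_assoc (iterTwist u v c k) x, twist, smul_mul_assoc, mul_smul_comm,
        pow_succ]
      simp only [mul_assoc]
      rw [← mul_assoc y x, ← hxy, mul_assoc]
    simp only [iterTwist, h, mul_smul_comm, smul_mul_assoc, h1, h2, mul_sub]
    module

theorem sum_eq_iterTwist (h : ℕ → ℕ → F) (z w : F) (h_zero : ∀ m, h m 0 = 1)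
    (h_self : ∀ m, h m (m + 1) = 0)
    (h_succ : ∀ m r, r ≤ m → h (m + 1) (r + 1) = h m (r + 1) + z ^ m * h m r) (u v : B) (m : ℕ) :
    ∑ r ∈ Finset.range (m + 1), ((-w) ^ r * h m r) • (u ^ (m - r) * v * u ^ r) =
      iterTwist u v (fun l => w * z ^ l) m := by
  induction m with
  | zero => simp [iterTwist, h_zero]
  | succ m ih =>
    have h1 : u * iterTwist u v (fun l => w * z ^ l) m =
        ∑ r ∈ Finset.range (m + 2), ((-w) ^ r * h m r) • (u ^ (m + 1 - r) * v * u ^ r) := by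
      rw [Finset.sum_range_succ, h_self, mul_zero, zero_smul, add_zero, ← ih, Finset.mul_sum]
      refine Finset.sum_congr rfl fun r hr => ?_
      rw [mul_smul_comm, Nat.succ_sub (Finset.mem_range_succ_iff.1 hr), pow_succ']
      simp only [mul_assoc]
    have h2 : iterTwist u v (fun l => w * z ^ l) m * u =
        ∑ r ∈ Finset.range (m + 1), ((-w) ^ r * h m r) • (u ^ (m - r) * v * u ^ (r + 1)) := by
      rw [← ih, Finset.sum_mul]
      refine Finset.sum_congr rfl fun r _ => ?_
      rw [smul_mul_assoc, pow_succ]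
      simp only [mul_assoc]
    rw [iterTwist, h1, h2, Finset.sum_range_succ', Finset.sum_range_succ' _ (m + 1),
      Finset.smul_sum, add_sub_right_comm, ← Finset.sum_sub_distrib, h_zero, h_zero]
    congr 1
    refine Finset.sum_congr rfl fun r hr => ?_
    rw [h_succ m r (Finset.mem_range_succ_iff.1 hr), Nat.add_sub_add_right]
    module

/-- If `S` is the `q`-Serre expression of order `m + 1`, written as an iterated twisted commutator
in two ways, it vanishes at `(f, g)` as soon as it takes the expected value on the translates
`(f + x, g + y)` by `q`-commuting elements. -/
theorem serre_eq_zero_of_translate {S : B → B → B} {p : F} (hp : p ≠ 0) (m : ℕ)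
    (hS : ∀ u v, S u v = iterTwist u v (fun l => p ^ (-(m : ℤ)) * (p ^ 2) ^ l) (m + 1))
    (hS' : ∀ u v, S u v = iterTwist u v (fun l => p ^ (m : ℤ) * ((p ^ 2)⁻¹) ^ l) (m + 1))
    {f g x y : B} (hf : x * f = p ^ 2 • (f * x)) (hg : x * g = p ^ (-(m : ℤ)) • (g * x))
    (hy : y * f = p ^ (-(m : ℤ)) • (f * y)) (hxy : x * y = y * x)
    (h : S (f + x) (g + y) =
      (∏ l ∈ Finset.range (m + 1), (1 - p ^ (m : ℤ) * ((p ^ 2)⁻¹) ^ l)) • (x ^ (m + 1) * y)) :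
    S f g = 0 := by
  have hf' : f * x = (p ^ 2)⁻¹ • (x * f) := by
    rw [hf, smul_smul, inv_mul_cancel₀ (by positivity), one_smul]
  have hy' : f * y = p ^ (m : ℤ) • (y * f) := by
    rw [hy, smul_smul, ← zpow_add₀ hp, add_neg_cancel, zpow_zero, one_smul]
  have hadd : S (f + x) (g + y) = S (f + x) g + S (f + x) y := by
    rw [hS, hS, hS, iterTwist_add]
  rw [hadd, hS' _ y, iterTwist_add_eq_prod hf' hy' hxy, hS, iterTwist_add_left_of_twist hf hg,
    ← hS] at h
  exact add_eq_right.1 h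

end QSerre

section QBinomial

theorem qi_ne_zero (di : ℕ) : qi K di ≠ 0 := pow_ne_zero _ RatFunc.X_ne_zero

theorem qi_pow_ne_one {di : ℕ} (hd : 0 < di) {k : ℕ} (hk : 0 < k) : qi K di ^ k ≠ 1 := by
  rw [qi, qv, ← pow_mul, ← RatFunc.algebraMap_X, ← map_pow,
    ← map_one (algebraMap (Polynomial K) (RatFunc K))]
  intro h
  have h' := congrArg Polynomial.natDegree (RatFunc.algebraMap_injective K h)
  rw [Polynomial.natDegree_X_pow, Polynomial.natDegree_one] at h'
  exact (Nat.mul_pos hd hk).ne' h'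

theorem qi_sub_inv_ne_zero {di : ℕ} (hd : 0 < di) : qi K di - (qi K di)⁻¹ ≠ 0 := by
  intro h
  refine qi_pow_ne_one K hd two_pos ?_
  rw [sub_eq_zero] at h
  rw [pow_two]
  nth_rewrite 1 [h]
  exact inv_mul_cancel₀ (qi_ne_zero K di)

theorem qnum_ne_zero {di : ℕ} (hd : 0 < di) {m : ℕ} (hm : 0 < m) : qnum K di m ≠ 0 := by
  refine div_ne_zero (fun h => ?_) (qi_sub_inv_ne_zero K hd)
  refine qi_pow_ne_one K hd (k := m + m) (by omega) ?_
  rw [sub_eq_zero, zpow_neg, zpow_natCast] at h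
  rw [pow_add]
  nth_rewrite 1 [h]
  exact inv_mul_cancel₀ (pow_ne_zero _ (qi_ne_zero K di))

theorem qfac_ne_zero {di : ℕ} (hd : 0 < di) (m : ℕ) : qfac K di m ≠ 0 := by
  induction m with
  | zero => exact one_ne_zero
  | succ m ih => exact mul_ne_zero (mod_cast qnum_ne_zero K hd m.succ_pos) ih

theorem qbin_zero_right {di : ℕ} (hd : 0 < di) (m : ℕ) : qbin K di m 0 = 1 := by
  simp [qbin, qfac, qfac_ne_zero K hd]

theorem qbin_self {di : ℕ} (hd : 0 < di) (m : ℕ) : qbin K di m m = 1 := by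
  simp [qbin, qfac, qfac_ne_zero K hd]

variable {K}

theorem qnum_add {di : ℕ} {p : Kq K} (hp : p = qi K di ∨ p = (qi K di)⁻¹) (a b : ℤ) :
    qnum K di (a + b) = p ^ b * qnum K di a + p ^ (-a) * qnum K di b := by
  have h0 := qi_ne_zero K di
  simp only [qnum]
  rcases hp with rfl | rfl
  · rw [mul_div_assoc', mul_div_assoc', ← add_div, mul_sub, mul_sub]
    simp only [← zpow_add₀ h0]
    congr 1
    ring_nf
  · rw [mul_div_assoc', mul_div_assoc', ← add_div, mul_sub, mul_sub]
    simp only [inv_zpow', ← zpow_add₀ h0]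
    congr 1
    ring_nf

theorem qbin_succ_succ {di : ℕ} (hd : 0 < di) {p : Kq K} (hp : p = qi K di ∨ p = (qi K di)⁻¹)
    {m r : ℕ} (hr : r < m) :
    qbin K di (m + 1) (r + 1) =
      p ^ (r + 1) * qbin K di m (r + 1) + p ^ ((r : ℤ) - m) * qbin K di m r := by
  obtain ⟨s, rfl⟩ := Nat.exists_eq_add_of_lt hr
  have hadd := qnum_add hp ((s : ℤ) + 1) (r + 1)
  have h1 : r + s + 1 + 1 - (r + 1) = s + 1 := by omega
  have h2 : r + s + 1 - (r + 1) = s := by omega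
  have h3 : r + s + 1 - r = s + 1 := by omega
  simp only [qbin, h1, h2, h3, qfac]
  have hr0 := qfac_ne_zero K hd r
  have hs0 := qfac_ne_zero K hd s
  have hr1 : qnum K di (r + 1) ≠ 0 := mod_cast qnum_ne_zero K hd r.succ_pos
  have hs1 : qnum K di (s + 1) ≠ 0 := mod_cast qnum_ne_zero K hd s.succ_pos
  have e1 : ((r + s + 1 : ℕ) : ℤ) + 1 = (s : ℤ) + 1 + (r + 1) := by push_cast; ring
  have e2 : (r : ℤ) - (r + s + 1 : ℕ) = -((s : ℤ) + 1) := by push_cast; ring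
  rw [e1, e2, hadd, show p ^ ((r : ℤ) + 1) = p ^ (r + 1) by exact_mod_cast zpow_natCast p (r + 1)]
  field_simp

variable {B : Type*} [Ring B] [Algebra (Kq K) B]

/-- The quantum Serre expression `∑ r, (-1)^r [m choose r]_i u^{m-r} v u^r`. -/
def qSerre (di m : ℕ) (u v : B) : B :=
  ∑ r ∈ Finset.range (m + 1),
    ((-1 : Kq K) ^ r * qbin K di m r) • (u ^ (m - r) * v * u ^ r)

theorem qSerre_eq_iterTwist {di : ℕ} (hd : 0 < di) {p : Kq K}
    (hp : p = qi K di ∨ p = (qi K di)⁻¹) (m : ℕ) (u v : B) :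
    qSerre (K := K) di (m + 1) u v =
      iterTwist u v (fun l => p ^ (m : ℤ) * ((p ^ 2)⁻¹) ^ l) (m + 1) := by
  have hp0 : p ≠ 0 := by
    rcases hp with rfl | rfl
    exacts [qi_ne_zero K di, inv_ne_zero (qi_ne_zero K di)]
  rw [← sum_eq_iterTwist
    (fun m r => if r ≤ m then p ^ ((1 - m : ℤ) * r) * qbin K di m r else 0)]
  · refine Finset.sum_congr rfl fun r hr => ?_
    rw [if_pos (Finset.mem_range_succ_iff.1 hr), neg_pow (p ^ (m : ℤ)), ← zpow_natCast (p ^ _),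
      ← zpow_mul, mul_assoc ((-1) ^ r), ← mul_assoc (p ^ _) (p ^ _), ← zpow_add₀ hp0,
      show (m : ℤ) * r + (1 - (m + 1 : ℕ)) * r = 0 by push_cast; ring, zpow_zero, one_mul]
  · intro m
    simp [qbin_zero_right K hd]
  · intro m
    simp
  · intro m r hr
    have hz : ((p ^ 2)⁻¹) ^ m = p ^ (-2 * m : ℤ) := by
      rw [zpow_mul, zpow_natCast, zpow_neg]; rfl
    rcases hr.lt_or_eq with hlt | rfl
    · rw [if_pos (by omega), if_pos (by omega), if_pos hr, qbin_succ_succ hd hp hlt, hz,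
        ← zpow_natCast p (r + 1), mul_add, ← mul_assoc, ← mul_assoc, ← mul_assoc,
        ← zpow_add₀ hp0, ← zpow_add₀ hp0, ← zpow_add₀ hp0]
      congr 3 <;> push_cast <;> ring
    · rw [if_pos le_rfl, if_neg (by omega), if_pos le_rfl, qbin_self K hd, qbin_self K hd, hz,
        zero_add, mul_one, mul_one, ← zpow_add₀ hp0]
      congr 1
      push_cast
      ring

theorem qSerre_smul {di : ℕ} (hd : 0 < di) (m : ℕ) (s t : Kq K) (u v : B) :
    qSerre (K := K) di (m + 1) (s • u) (t • v) =
      (s ^ (m + 1) * t) • qSerre (K := K) di (m + 1) u v := by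
  rw [qSerre_eq_iterTwist hd (.inl rfl), qSerre_eq_iterTwist hd (.inl rfl), iterTwist_smul]

theorem qSerre_eq_zero_of_translate {di : ℕ} (hd : 0 < di) {p : Kq K}
    (hp : p = qi K di ∨ p = (qi K di)⁻¹) (m : ℕ) {f g x y : B}
    (hf : x * f = p ^ 2 • (f * x)) (hg : x * g = p ^ (-(m : ℤ)) • (g * x))
    (hy : y * f = p ^ (-(m : ℤ)) • (f * y)) (hxy : x * y = y * x)
    (h : qSerre (K := K) di (m + 1) (f + x) (g + y) =
      (∏ l ∈ Finset.range (m + 1), (1 - qi K di ^ (-(m : ℤ) + 2 * l))) • (x ^ (m + 1) * y)) :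
    qSerre (K := K) di (m + 1) f g = 0 := by
  have hq0 := qi_ne_zero K di
  have hp0 : p ≠ 0 := by
    rcases hp with rfl | rfl
    exacts [hq0, inv_ne_zero hq0]
  have hp' : p⁻¹ = qi K di ∨ p⁻¹ = (qi K di)⁻¹ := by
    rcases hp with rfl | rfl
    exacts [.inr rfl, .inl (inv_inv _)]
  refine serre_eq_zero_of_translate hp0 m (fun u v => ?_)
    (qSerre_eq_iterTwist hd hp m) hf hg hy hxy ?_
  · rw [qSerre_eq_iterTwist hd hp']
    simp
  · rw [h]
    congr 1
    rcases hp with rfl | rfl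
    · rw [← Finset.prod_range_reflect]
      refine Finset.prod_congr rfl fun l hl => ?_
      have hl' := Finset.mem_range_succ_iff.1 hl
      rw [← zpow_natCast (qi K di) 2, ← zpow_neg, ← zpow_natCast (_ ^ _), ← zpow_mul,
        ← zpow_add₀ hq0]
      congr 2
      push_cast [Nat.add_sub_cancel, hl']
      ring
    · refine Finset.prod_congr rfl fun l _ => ?_
      rw [inv_zpow', inv_pow, inv_pow, inv_pow, inv_inv, ← pow_mul, ← zpow_natCast, ← zpow_add₀ hq0]
      push_cast
      rfl

end QBinomial

section TwistInverse

variable {F B : Type*} [Field F] [Ring B] [Algebra F B]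

theorem twist_inverse {X x t : B} {b : F} (hXx : X * x = 1) (hxX : x * X = 1)
    (h : t * X = b • (X * t)) : x * t = b • (t * x) := by
  calc x * t = x * (t * X) * x := by rw [mul_assoc, mul_assoc, hXx, mul_one]
    _ = b • (t * x) := by
      rw [h, mul_smul_comm, smul_mul_assoc, ← mul_assoc, hxX, one_mul]

theorem twist_symm {x t : B} {b : F} (hb : b ≠ 0) (h : x * t = b • (t * x)) :
    t * x = b⁻¹ • (x * t) := by
  rw [h, smul_smul, inv_mul_cancel₀ hb, one_smul]

theorem one_sub_smul_add_smul_sub (a : F) (s t : B) :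
    (1 - a) • s + a • t - s = a • (t - s) := by
  module

theorem commutator_of_twist {X y Y Z w : B} {a : F}
    (hYX : Y * X - a • (X * Y) = (1 - a) • (y * X)) (hZY : Z * Y - a • (Y * Z) = (1 - a) • w)
    (hZy : (1 - X * Z) * y = a • (y * (1 - X * Z))) :
    (1 - X * Z) * (Y - y) - (Y - y) * (1 - X * Z) = (1 - a) • (y - X * w) := by
  have hYX' : Y * (X * Z) = (1 - a) • (y * (X * Z)) + a • (X * (Y * Z)) := by
    rw [← mul_assoc, sub_eq_iff_eq_add.1 hYX]
    simp only [add_mul, smul_mul_assoc, mul_assoc]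
  have hXZY : X * Z * Y = (1 - a) • (X * w) + a • (X * (Y * Z)) := by
    rw [mul_assoc, sub_eq_iff_eq_add.1 hZY, mul_add, mul_smul_comm, mul_smul_comm]
  rw [mul_sub, hZy, sub_mul 1, hXZY, one_mul, sub_mul Y, mul_sub Y, mul_sub y, mul_one, mul_one,
    hYX']
  module

end TwistInverse

/-- The elements `X_i`, `X_i⁻¹ = x_i`, `Y_i`, `Z_i` of an algebra satisfy (E1)–(E8). -/
structure IsEquitable {B : Type*} [Ring B] [Algebra (Kq K) B] (X x Y Z : Fin n → B) : Prop where
  mul_inv : ∀ i, X i * x i = 1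
  inv_mul : ∀ i, x i * X i = 1
  comm : ∀ i j, X i * X j = X j * X i
  Y_mul_X : ∀ i j, Y i * X j - qi K (d i) ^ A i j • (X j * Y i) =
    (1 - qi K (d i) ^ A i j) • (x i * X j)
  X_mul_Z : ∀ i j, X i * Z j - qi K (d i) ^ A i j • (Z j * X i) =
    (1 - qi K (d i) ^ A i j) • (X i * x j)
  Z_mul_Y_self : ∀ i, Z i * Y i - qi K (d i) ^ 2 • (Y i * Z i) = (1 - qi K (d i) ^ 2) • 1
  Z_mul_Y : ∀ i j, i ≠ j → Z i * Y j - qi K (d i) ^ A i j • (Y j * Z i) =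
    (1 - qi K (d i) ^ A i j) • (x i * x j)
  qSerre_Y : ∀ i j, i ≠ j → qSerre (K := K) (d i) (1 - A i j).toNat (Y i) (Y j) =
    (∏ s ∈ Finset.range ((-(A i j)).toNat + 1), (1 - qi K (d i) ^ (A i j + 2 * (s : ℤ)))) •
      (x i ^ (1 - A i j).toNat * x j)
  qSerre_Z : ∀ i j, i ≠ j → qSerre (K := K) (d i) (1 - A i j).toNat (Z i) (Z j) =
    (∏ s ∈ Finset.range ((-(A i j)).toNat + 1), (1 - qi K (d i) ^ (A i j + 2 * (s : ℤ)))) •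
      (x i ^ (1 - A i j).toNat * x j)

theorem isEquitable_gen :
    IsEquitable K A d (genX K A d) (genXinv K A d) (genY K A d) (genZ K A d) where
  mul_inv i := by
    simpa [genX, genXinv] using RingQuot.mkAlgHom_rel (Kq K) (ERel.E1a (K := K) (A := A) (d := d) i)
  inv_mul i := by
    simpa [genX, genXinv] using RingQuot.mkAlgHom_rel (Kq K) (ERel.E1b (K := K) (A := A) (d := d) i)
  comm i j := by
    simpa [genX] using RingQuot.mkAlgHom_rel (Kq K) (ERel.E2 (K := K) (A := A) (d := d) i j)
  Y_mul_X i j := by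
    simpa only [genX, genXinv, genY, map_sub, map_mul, map_smul] using
      RingQuot.mkAlgHom_rel (Kq K) (ERel.E3 (K := K) (A := A) (d := d) i j)
  X_mul_Z i j := by
    simpa only [genX, genXinv, genZ, map_sub, map_mul, map_smul] using
      RingQuot.mkAlgHom_rel (Kq K) (ERel.E4 (K := K) (A := A) (d := d) i j)
  Z_mul_Y_self i := by
    simpa only [genY, genZ, map_sub, map_mul, map_smul, map_one] using
      RingQuot.mkAlgHom_rel (Kq K) (ERel.E5 (K := K) (A := A) (d := d) i)
  Z_mul_Y i j hij := by
    simpa only [genXinv, genY, genZ, map_sub, map_mul, map_smul] using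
      RingQuot.mkAlgHom_rel (Kq K) (ERel.E6 (K := K) (A := A) (d := d) i j hij)
  qSerre_Y i j hij := by
    simpa only [qSerre, genXinv, genY, map_sum, map_mul, map_smul, map_pow] using
      RingQuot.mkAlgHom_rel (Kq K) (ERel.E7 (K := K) (A := A) (d := d) i j hij)
  qSerre_Z i j hij := by
    simpa only [qSerre, genXinv, genZ, map_sum, map_mul, map_smul, map_pow] using
      RingQuot.mkAlgHom_rel (Kq K) (ERel.E8 (K := K) (A := A) (d := d) i j hij)

variable {K A d}

namespace IsSymmetrizableGCM

theorem qi_zpow_symm (hA : IsSymmetrizableGCM A d) (i j : Fin n) :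
    qi K (d i) ^ A i j = qi K (d j) ^ A j i := by
  simp only [qi, ← zpow_natCast, ← zpow_mul, hA.2.2.2.2.2 i j]

theorem exists_eq_neg_natCast (hA : IsSymmetrizableGCM A d) {i j : Fin n} (hij : i ≠ j) :
    ∃ m : ℕ, A i j = -(m : ℤ) ∧ (-(A i j)).toNat = m ∧ (1 - A i j).toNat = m + 1 := by
  have := hA.2.2.1 i j hij
  exact ⟨(-(A i j)).toNat, by omega, rfl, by omega⟩

end IsSymmetrizableGCM

namespace IsEquitable

variable {B : Type*} [Ring B] [Algebra (Kq K) B] {X x Y Z : Fin n → B}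
  (hE : IsEquitable K A d X x Y Z) (hA : IsSymmetrizableGCM A d)
include hE

theorem isUnit_X (i : Fin n) : IsUnit (X i) :=
  ⟨⟨_, _, hE.mul_inv i, hE.inv_mul i⟩, rfl⟩

theorem isUnit_inv (i : Fin n) : IsUnit (x i) :=
  ⟨⟨_, _, hE.inv_mul i, hE.mul_inv i⟩, rfl⟩

theorem inv_mul_X_comm (i j : Fin n) : x i * X j = X j * x i := by
  apply (hE.isUnit_X i).mul_left_cancel
  rw [← mul_assoc, ← mul_assoc, hE.mul_inv, hE.comm, mul_assoc, hE.mul_inv, one_mul, mul_one]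

theorem inv_comm (i j : Fin n) : x i * x j = x j * x i := by
  apply (hE.isUnit_X j).mul_left_cancel
  rw [← mul_assoc, ← mul_assoc, ← hE.inv_mul_X_comm, mul_assoc, hE.mul_inv, one_mul, mul_one]

include hA in
theorem Y_sub_mul_X (i j : Fin n) :
    (Y j - x j) * X i = qi K (d i) ^ A i j • (X i * (Y j - x j)) := by
  have h := sub_eq_iff_eq_add.1 (hE.Y_mul_X j i)
  rw [← hA.qi_zpow_symm i j] at h
  rw [sub_mul, mul_sub, h, one_sub_smul_add_smul_sub, hE.inv_mul_X_comm]

include hA in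
theorem inv_mul_Y_sub (i j : Fin n) :
    x i * (Y j - x j) = qi K (d i) ^ A i j • ((Y j - x j) * x i) :=
  twist_inverse (hE.mul_inv i) (hE.inv_mul i) (hE.Y_sub_mul_X hA i j)

theorem X_mul_Z_sub (i j : Fin n) :
    X i * (Z j - x j) = qi K (d i) ^ A i j • ((Z j - x j) * X i) := by
  rw [sub_mul, mul_sub, sub_eq_iff_eq_add.1 (hE.X_mul_Z i j), hE.inv_mul_X_comm,
    one_sub_smul_add_smul_sub]

theorem inv_mul_Z_sub (i j : Fin n) :
    x i * (Z j - x j) = (qi K (d i) ^ A i j)⁻¹ • ((Z j - x j) * x i) :=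
  twist_inverse (hE.mul_inv i) (hE.inv_mul i)
    (twist_symm (zpow_ne_zero _ (qi_ne_zero K (d i))) (hE.X_mul_Z_sub i j))

theorem X_mul_one_sub (i j : Fin n) :
    X i * (1 - X j * Z j) = qi K (d i) ^ A i j • ((1 - X j * Z j) * X i) := by
  have e : 1 - X j * Z j = -(X j * (Z j - x j)) := by
    rw [mul_sub, hE.mul_inv, neg_sub]
  rw [e, mul_neg, ← mul_assoc, hE.comm, mul_assoc, hE.X_mul_Z_sub, neg_mul,
    mul_smul_comm, smul_neg, mul_assoc]

theorem one_sub_mul_inv (i j : Fin n) :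
    (1 - X j * Z j) * x i = qi K (d i) ^ A i j • (x i * (1 - X j * Z j)) := by
  have h0 : qi K (d i) ^ A i j ≠ 0 := zpow_ne_zero _ (qi_ne_zero K (d i))
  simpa only [inv_inv] using twist_symm (inv_ne_zero h0) <|
    twist_inverse (hE.mul_inv i) (hE.inv_mul i) (twist_symm h0 (hE.X_mul_one_sub i j))

include hA in
theorem one_sub_mul_Y_sub (i j : Fin n) :
    (1 - X i * Z i) * (Y j - x j) - (Y j - x j) * (1 - X i * Z i) =
      if i = j then (1 - qi K (d i) ^ 2) • (x i - X i) else 0 := by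
  have hA2 : A i i = 2 := hA.2.1 i
  obtain ⟨w, hw, hw'⟩ : ∃ w : B,
      Z i * Y j - qi K (d i) ^ A i j • (Y j * Z i) = (1 - qi K (d i) ^ A i j) • w ∧
      (1 - qi K (d i) ^ A i j) • (x j - X i * w) =
        if i = j then (1 - qi K (d i) ^ 2) • (x i - X i) else 0 := by
    by_cases hij : i = j
    · subst hij
      refine ⟨1, ?_, ?_⟩
      · rw [hA2]
        exact hE.Z_mul_Y_self i
      · rw [if_pos rfl, mul_one, hA2]
        rfl
    · refine ⟨_, hE.Z_mul_Y i j hij, ?_⟩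
      rw [if_neg hij, ← mul_assoc, hE.mul_inv, one_mul, sub_self, smul_zero]
  have hYX := hE.Y_mul_X j i
  have hZy := hE.one_sub_mul_inv j i
  rw [← hA.qi_zpow_symm i j] at hYX hZy
  rw [← hw']
  exact commutator_of_twist hYX hw hZy

include hA in
theorem qSerre_Y_sub {i j : Fin n} (hij : i ≠ j) :
    qSerre (K := K) (d i) (1 - A i j).toNat (Y i - x i) (Y j - x j) = 0 := by
  obtain ⟨m, hm, hm', hm''⟩ := hA.exists_eq_neg_natCast hij
  have hs := hE.qSerre_Y i j hij
  rw [hm', hm'', hm] at hs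
  rw [hm'']
  refine qSerre_eq_zero_of_translate (hA.2.2.2.1 i) (.inl rfl) m
    (x := x i) (y := x j) ?_ ?_ ?_ (hE.inv_comm i j) ?_
  · have h := hE.inv_mul_Y_sub hA i i
    rw [hA.2.1 i] at h
    exact h
  · rw [← hm]
    exact hE.inv_mul_Y_sub hA i j
  · rw [← hm, hA.qi_zpow_symm i j]
    exact hE.inv_mul_Y_sub hA j i
  · rw [sub_add_cancel, sub_add_cancel, hs]

include hA in
theorem qSerre_Z_sub {i j : Fin n} (hij : i ≠ j) :
    qSerre (K := K) (d i) (1 - A i j).toNat (Z i - x i) (Z j - x j) = 0 := by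
  obtain ⟨m, hm, hm', hm''⟩ := hA.exists_eq_neg_natCast hij
  have hs := hE.qSerre_Z i j hij
  rw [hm', hm'', hm] at hs
  rw [hm'']
  refine qSerre_eq_zero_of_translate (hA.2.2.2.1 i) (.inr rfl) m
    (x := x i) (y := x j) ?_ ?_ ?_ (hE.inv_comm i j) ?_
  · have h := hE.inv_mul_Z_sub i i
    rw [hA.2.1 i] at h
    rw [inv_pow]
    exact h
  · rw [← hm, inv_zpow]
    exact hE.inv_mul_Z_sub i j
  · rw [← hm, inv_zpow, hA.qi_zpow_symm i j]
    exact hE.inv_mul_Z_sub j i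
  · rw [sub_add_cancel, sub_add_cancel, hs]

include hA in
theorem qSerre_one_sub {i j : Fin n} (hij : i ≠ j) :
    qSerre (K := K) (d i) (1 - A i j).toNat (1 - X i * Z i) (1 - X j * Z j) = 0 := by
  obtain ⟨m, -, -, hm⟩ := hA.exists_eq_neg_natCast hij
  have hd := hA.2.2.2.1 i
  have h0 : ∀ j, qi K (d i) ^ A i j ≠ 0 := fun j => zpow_ne_zero _ (qi_ne_zero K (d i))
  have e (k : Fin n) : Z k - x k = (-1 : Kq K) • (x k * (1 - X k * Z k)) := by
    rw [mul_sub, ← mul_assoc, hE.inv_mul, mul_one, one_mul, neg_one_smul, neg_sub]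
  have h := hE.qSerre_Z_sub hA hij
  have huy := hE.one_sub_mul_inv j i
  rw [← hA.qi_zpow_symm i j] at huy
  rw [e, e, hm, qSerre_smul hd, qSerre_eq_iterTwist hd (.inl rfl)] at h
  rw [hm, qSerre_eq_iterTwist hd (.inl rfl)]
  obtain ⟨b, hb, hb'⟩ := iterTwist_mul_of_twist (hE.one_sub_mul_inv i i) huy
    (hE.one_sub_mul_inv i j) (h0 i) (h0 j) (hE.inv_comm i j)
    (fun l => qi K (d i) ^ (m : ℤ) * ((qi K (d i) ^ 2)⁻¹) ^ l) (m + 1)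
  rw [hb', smul_smul, smul_eq_zero_iff_right (mul_ne_zero (by simp) hb)] at h
  exact (((hE.isUnit_inv i).pow (m + 1)).mul (hE.isUnit_inv j)).mul_right_eq_zero.1 h

theorem chevalley_X_E (i j : Fin n) (c : Kq K) :
    X i * (c • (1 - X j * Z j)) * x i = qi K (d i) ^ A i j • c • (1 - X j * Z j) := by
  rw [mul_smul_comm, hE.X_mul_one_sub, smul_mul_assoc, smul_mul_assoc, mul_assoc, hE.mul_inv,
    mul_one, smul_comm]

include hA in
theorem chevalley_X_F (i j : Fin n) (c : Kq K) :
    X i * (c • (Y j - x j)) * x i = qi K (d i) ^ (-(A i j)) • c • (Y j - x j) := by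
  rw [mul_smul_comm, twist_inverse (hE.inv_mul i) (hE.mul_inv i)
      (twist_symm (zpow_ne_zero _ (qi_ne_zero K (d i))) (hE.inv_mul_Y_sub hA i j)),
    smul_mul_assoc, smul_mul_assoc, mul_assoc, hE.mul_inv, mul_one, smul_comm, zpow_neg]

include hA in
theorem chevalley_E_F (i j : Fin n) :
    (((qi K (d i))⁻¹ * (qi K (d i) - (qi K (d i))⁻¹)⁻¹) • (1 - X i * Z i)) *
        ((qi K (d j) - (qi K (d j))⁻¹)⁻¹ • (Y j - x j)) -
      ((qi K (d j) - (qi K (d j))⁻¹)⁻¹ • (Y j - x j)) *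
        (((qi K (d i))⁻¹ * (qi K (d i) - (qi K (d i))⁻¹)⁻¹) • (1 - X i * Z i)) =
      if i = j then (qi K (d i) - (qi K (d i))⁻¹)⁻¹ • (X i - x i) else 0 := by
  have hq := qi_ne_zero K (d i)
  have hq' := qi_sub_inv_ne_zero K (hA.2.2.2.1 i)
  simp only [smul_mul_assoc, mul_smul_comm]
  rw [smul_comm (qi K (d j) - _)⁻¹, ← smul_sub, ← smul_sub, hE.one_sub_mul_Y_sub hA]
  split_ifs with hij
  · subst hij
    rw [smul_smul, smul_smul, ← neg_sub (X i), smul_neg, ← neg_smul]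
    congr 1
    have e : 1 - qi K (d i) ^ 2 = -(qi K (d i) * (qi K (d i) - (qi K (d i))⁻¹)) := by
      rw [mul_sub, mul_inv_cancel₀ hq]
      ring
    rw [e]
    generalize qi K (d i) - (qi K (d i))⁻¹ = t at hq' ⊢
    field_simp
  · rw [smul_zero, smul_zero]

include hA in
theorem chevalley_serre_E {i j : Fin n} (hij : i ≠ j) (s t : Kq K) :
    qSerre (K := K) (d i) (1 - A i j).toNat (s • (1 - X i * Z i)) (t • (1 - X j * Z j)) = 0 := by
  have h := hE.qSerre_one_sub hA hij
  obtain ⟨m, -, -, hm⟩ := hA.exists_eq_neg_natCast hij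
  rw [hm] at h ⊢
  rw [qSerre_smul (hA.2.2.2.1 i), h, smul_zero]

include hA in
theorem chevalley_serre_F {i j : Fin n} (hij : i ≠ j) (s t : Kq K) :
    qSerre (K := K) (d i) (1 - A i j).toNat (s • (Y i - x i)) (t • (Y j - x j)) = 0 := by
  have h := hE.qSerre_Y_sub hA hij
  obtain ⟨m, -, -, hm⟩ := hA.exists_eq_neg_natCast hij
  rw [hm] at h ⊢
  rw [qSerre_smul (hA.2.2.2.1 i), h, smul_zero]

end IsEquitable

variable (K A d)

/-- In the equitable algebra `U` the elements `K̃_i^{±1}, Ẽ_i, F̃_i`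
satisfy the Chevalley relations (R1)–(R7); consequently there is an algebra homomorphism
from `U_q(g)` to `U` sending `E_i ↦ Ẽ_i`, `F_i ↦ F̃_i`, `K_i^{±1} ↦ K̃_i^{±1}`. -/
theorem tilde_elements_satisfy_chevalley_relations (hA : IsSymmetrizableGCM A d) :
    (∀ i, tilK K A d i * tilKinv K A d i = 1 ∧ tilKinv K A d i * tilK K A d i = 1) ∧
    (∀ i j, tilK K A d i * tilK K A d j = tilK K A d j * tilK K A d i) ∧
    (∀ i j, tilK K A d i * tilE K A d j * tilKinv K A d i =
      qi K (d i) ^ (A i j) • tilE K A d j) ∧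
    (∀ i j, tilK K A d i * tilF K A d j * tilKinv K A d i =
      qi K (d i) ^ (-(A i j)) • tilF K A d j) ∧
    (∀ i j, tilE K A d i * tilF K A d j - tilF K A d j * tilE K A d i =
      if i = j then (qi K (d i) - (qi K (d i))⁻¹)⁻¹ • (tilK K A d i - tilKinv K A d i)
      else 0) ∧
    (∀ i j, i ≠ j →
      ∑ r ∈ Finset.range ((1 - A i j).toNat + 1),
        ((-1 : Kq K) ^ r * qbin K (d i) (1 - A i j).toNat r) •
          (tilE K A d i ^ ((1 - A i j).toNat - r) * tilE K A d j * tilE K A d i ^ r) = 0) ∧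
    (∀ i j, i ≠ j →
      ∑ r ∈ Finset.range ((1 - A i j).toNat + 1),
        ((-1 : Kq K) ^ r * qbin K (d i) (1 - A i j).toNat r) •
          (tilF K A d i ^ ((1 - A i j).toNat - r) * tilF K A d j * tilF K A d i ^ r) = 0) ∧
    (∃ φ : Uqg K A d →ₐ[Kq K] Ueqg K A d, ∀ i,
      φ (genE K A d i) = tilE K A d i ∧ φ (genF K A d i) = tilF K A d i ∧
      φ (genK K A d i) = tilK K A d i ∧ φ (genKinv K A d i) = tilKinv K A d i) := by
  have hE := isEquitable_gen K A d
  have hR1 i : tilK K A d i * tilKinv K A d i = 1 := hE.mul_inv i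
  have hR1' i : tilKinv K A d i * tilK K A d i = 1 := hE.inv_mul i
  have hR2 i j : tilK K A d i * tilK K A d j = tilK K A d j * tilK K A d i := hE.comm i j
  have hR3 i j : tilK K A d i * tilE K A d j * tilKinv K A d i =
      qi K (d i) ^ (A i j) • tilE K A d j := hE.chevalley_X_E i j _
  have hR4 i j : tilK K A d i * tilF K A d j * tilKinv K A d i =
      qi K (d i) ^ (-(A i j)) • tilF K A d j := hE.chevalley_X_F hA i j _
  have hR5 i j : tilE K A d i * tilF K A d j - tilF K A d j * tilE K A d i =
      if i = j then (qi K (d i) - (qi K (d i))⁻¹)⁻¹ • (tilK K A d i - tilKinv K A d i)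
      else 0 := hE.chevalley_E_F hA i j
  have hR6 i j (hij : i ≠ j) : ∑ r ∈ Finset.range ((1 - A i j).toNat + 1),
        ((-1 : Kq K) ^ r * qbin K (d i) (1 - A i j).toNat r) •
          (tilE K A d i ^ ((1 - A i j).toNat - r) * tilE K A d j * tilE K A d i ^ r) = 0 :=
    hE.chevalley_serre_E hA hij _ _
  have hR7 i j (hij : i ≠ j) : ∑ r ∈ Finset.range ((1 - A i j).toNat + 1),
        ((-1 : Kq K) ^ r * qbin K (d i) (1 - A i j).toNat r) •
          (tilF K A d i ^ ((1 - A i j).toNat - r) * tilF K A d j * tilF K A d i ^ r) = 0 :=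
    hE.chevalley_serre_F hA hij _ _
  refine ⟨fun i => ⟨hR1 i, hR1' i⟩, hR2, hR3, hR4, hR5, hR6, hR7, ?_⟩
  let gen : CGen n → Ueqg K A d
    | .E i => tilE K A d i
    | .F i => tilF K A d i
    | .K i => tilK K A d i
    | .Kinv i => tilKinv K A d i
  have hgen ⦃a b : FreeAlgebra (Kq K) (CGen n)⦄ (h : CRel K A d a b) :
      FreeAlgebra.lift (Kq K) gen a = FreeAlgebra.lift (Kq K) gen b := by
    induction h with
    | R1a i => simpa [gen] using hR1 i
    | R1b i => simpa [gen] using hR1' i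
    | R2 i j => simpa [gen] using hR2 i j
    | R3 i j => simpa only [map_mul, map_smul, lift_ι_apply] using hR3 i j
    | R4 i j => simpa only [map_mul, map_smul, lift_ι_apply] using hR4 i j
    | R5 i j =>
      rw [apply_ite (FreeAlgebra.lift (Kq K) gen)]
      simpa only [map_sub, map_mul, map_smul, map_zero, lift_ι_apply] using hR5 i j
    | R6 i j hij =>
      simpa only [map_sum, map_mul, map_smul, map_pow, map_zero, lift_ι_apply] using hR6 i j hij
    | R7 i j hij =>
      simpa only [map_sum, map_mul, map_smul, map_pow, map_zero, lift_ι_apply] using hR7 i j hij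
  refine ⟨RingQuot.liftAlgHom (Kq K) ⟨FreeAlgebra.lift (Kq K) gen, hgen⟩, fun i => ?_⟩
  simp only [genE, genF, genK, genKinv, RingQuot.liftAlgHom_mkAlgHom_apply, lift_ι_apply, gen,
    and_self]

end Statement5
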